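/- arXiv:2509.25997 — 2 statements merged into one kernel-verified Lean document; each statement's English description precedes it below -/
import Mathlib

section
/- Let d ≥ 3 be odd, let q be an odd prime power, let i ∈ {3,4}, and let r ∈ F_q \ {0}. Then for every nonempty set P ⊆ F_q^d and every nonempty set S of Q_i^d-spheres all having radius r, |I(P,S) − q^{−1}|P||S|| < 3·q^{(d−1)/2}·|P|^{1/2}|S|^{1/2}. -/
open Finset

section Defs
variable {F : Type*} [Field F] [Fintype F] [DecidableEq F]

/-- `x₁x₂ + x₃x₄ + ⋯` : the sum of the first `k` products of consecutive pairs
of coordinates. -/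
def pairsForm {d : ℕ} (k : ℕ) (x : Fin d → F) : F :=
  ∑ j ∈ Finset.range k, if h : 2*j+1 < d then x ⟨2*j, by omega⟩ * x ⟨2*j+1, h⟩ else 0

/-- `Q₁^d(x) = x₁x₂ + x₃x₄ + ⋯ + x_{d−1}x_d` (for even `d`). -/
def Q1form {d : ℕ} (x : Fin d → F) : F := pairsForm (d/2) x

/-- `Q₂^d(x) = x₁x₂ + ⋯ + x_{d−3}x_{d−2} + x_{d−1}² − a·x_d²` (for even `d`,
`a` a non-square). -/
def Q2form (a : F) {d : ℕ} (x : Fin d → F) : F :=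
  pairsForm ((d-2)/2) x +
    (if h : 2 ≤ d then x ⟨d-2, by omega⟩ ^ 2 - a * x ⟨d-1, by omega⟩ ^ 2 else 0)

/-- `Q₃^d(x) = x₁x₂ + ⋯ + x_{d−2}x_{d−1} − x_d²` (for odd `d`). -/
def Q3form {d : ℕ} (x : Fin d → F) : F :=
  pairsForm ((d-1)/2) x - (if h : 1 ≤ d then x ⟨d-1, by omega⟩ ^ 2 else 0)

/-- `Q₄^d(x) = x₁x₂ + ⋯ + x_{d−2}x_{d−1} − a·x_d²` (for odd `d`, `a` a non-square). -/
def Q4form (a : F) {d : ℕ} (x : Fin d → F) : F :=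
  pairsForm ((d-1)/2) x - (if h : 1 ≤ d then a * x ⟨d-1, by omega⟩ ^ 2 else 0)

/-- The quadratic form `Q_i^d`. -/
def Qi (a : F) (i : ℕ) {d : ℕ} (x : Fin d → F) : F :=
  if i = 1 then Q1form x else if i = 2 then Q2form a x
  else if i = 3 then Q3form x else Q4form a x

/-- `‖x‖ = x₁² + ⋯ + x_d²`. -/
def normForm {d : ℕ} (x : Fin d → F) : F := ∑ i, x i ^ 2

/-- `I(P,S)`: the number of incidences between a set `P` of points and a set `S`
of `Qf`-spheres, each sphere given as a (center, radius) pair. -/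
def sphIncid {d : ℕ} (Qf : (Fin d → F) → F)
    (P : Finset (Fin d → F)) (S : Finset ((Fin d → F) × F)) : ℕ :=
  ((P ×ˢ S).filter fun z => Qf (z.1 - z.2.1) = z.2.2).card

/-- The set of points of the `Qf`-sphere `s` (given as a (center, radius) pair). -/
def spherePts {d : ℕ} (Qf : (Fin d → F) → F) (s : (Fin d → F) × F) : Finset (Fin d → F) :=
  Finset.univ.filter fun x => Qf (x - s.1) = s.2

end Defs

/-! ### Exponential sums over finite fields -/

section ExponentialSums
variable {F : Type*} [Field F] [Fintype F] [DecidableEq F]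

/-- The quadratic character of `F` with values in `ℂ`. -/
noncomputable def complexQuadraticChar (F : Type*) [Field F] [Fintype F] [DecidableEq F] :
    MulChar F ℂ :=
  (quadraticChar F).ringHomComp (Int.castRingHom ℂ)

lemma complexQuadraticChar_apply (t : F) :
    complexQuadraticChar F t = (quadraticChar F t : ℂ) := rfl

lemma complexQuadraticChar_sq {t : F} (ht : t ≠ 0) :
    complexQuadraticChar F t * complexQuadraticChar F t = 1 := by
  rw [complexQuadraticChar_apply, ← Int.cast_mul, ← sq, quadraticChar_sq_one ht, Int.cast_one]

lemma norm_complexQuadraticChar {t : F} (ht : t ≠ 0) : ‖complexQuadraticChar F t‖ = 1 := by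
  have h := congrArg norm (complexQuadraticChar_sq ht)
  rw [norm_mul, norm_one] at h
  nlinarith [norm_nonneg (complexQuadraticChar F t)]

lemma complexQuadraticChar_ne_one (hF : ringChar F ≠ 2) : complexQuadraticChar F ≠ 1 := by
  intro h
  obtain ⟨t, ht⟩ := quadraticChar_exists_neg_one' hF
  have h1 := congrArg (fun χ : MulChar F ℂ => χ (t : F)) h
  simp only [complexQuadraticChar_apply, ht, MulChar.one_apply_coe] at h1
  norm_num at h1

lemma norm_gaussSum_sq (hF : ringChar F ≠ 2) {ψ : AddChar F ℂ} (hψ : ψ.IsPrimitive) :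
    ‖gaussSum (complexQuadraticChar F) ψ‖ ^ 2 = Fintype.card F := by
  have h := gaussSum_mul_gaussSum_eq_card (complexQuadraticChar_ne_one hF) hψ
  rw [← star_gaussSum_eq] at h
  have h1 := congrArg norm h
  rwa [norm_mul, norm_star, ← sq, Complex.norm_natCast] at h1

/-- The quadratic exponential sum is a Gauss sum. -/
lemma sum_mul_sq (hF : ringChar F ≠ 2) {ψ : AddChar F ℂ} (hψ : ψ.IsPrimitive) {t : F}
    (ht : t ≠ 0) :
    ∑ w : F, ψ (t * w ^ 2) = complexQuadraticChar F t * gaussSum (complexQuadraticChar F) ψ := by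
  have h1 : ∑ w : F, ψ (t * w ^ 2) = ∑ x : F, (complexQuadraticChar F x + 1) * ψ (t * x) := by
    rw [← Finset.sum_fiberwise (s := univ) (g := fun w : F => w ^ 2)]
    refine Finset.sum_congr rfl fun x _ => ?_
    have h2 := quadraticChar_card_sqrts hF x
    rw [Finset.sum_congr rfl (g := fun _ => ψ (t * x))
      (fun w hw => by rw [(Finset.mem_filter.1 hw).2]), Finset.sum_const, nsmul_eq_mul]
    congr 1
    rw [complexQuadraticChar_apply]
    have h3 : ((({w : F | w ^ 2 = x} : Finset F).card : ℤ)) = quadraticChar F x + 1 := by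
      rw [← h2]; congr 2; ext w; simp
    exact_mod_cast congrArg (Int.cast : ℤ → ℂ) h3
  have h2 : ∑ x : F, ψ (t * x) = 0 := by
    have := AddChar.sum_mulShift t hψ
    simpa [mul_comm, ht] using this
  have h3 := gaussSum_mulShift (complexQuadraticChar F) ψ (Units.mk0 t ht)
  simp only [gaussSum, AddChar.mulShift_apply, Units.val_mk0] at h3
  rw [h1]
  simp only [add_mul, one_mul, Finset.sum_add_distrib, h2, add_zero]
  rw [gaussSum, ← h3, ← mul_assoc, complexQuadraticChar_sq ht, one_mul]

lemma sum_erase_zero_mul {ψ : AddChar F ℂ} (hψ : ψ.IsPrimitive) (b : F) :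
    ∑ t ∈ univ.erase (0 : F), ψ (t * b) = (if b = 0 then (Fintype.card F : ℂ) else 0) - 1 := by
  have h := AddChar.sum_mulShift b hψ
  rw [← Finset.sum_erase_add _ _ (Finset.mem_univ (0 : F)), zero_mul, AddChar.map_zero_eq_one] at h
  rw [eq_sub_iff_add_eq, h]
  push_cast
  rfl

/-- The Salié sum with parameters `u` and `y² / (4u)`. -/
lemma norm_salie_le_of_sq (hF : ringChar F ≠ 2) {ψ : AddChar F ℂ} (hψ : ψ.IsPrimitive) {u : F}
    (hu : u ≠ 0) (y : F) :
    ‖∑ t ∈ univ.erase (0 : F), complexQuadraticChar F t * ψ (u * t + y ^ 2 / (4 * u) / t)‖ ^ 2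
      ≤ 4 * Fintype.card F := by
  set T := ∑ t ∈ univ.erase (0 : F), complexQuadraticChar F t * ψ (u * t + y ^ 2 / (4 * u) / t)
  set G := gaussSum (complexQuadraticChar F) ψ with hG
  have h2 := Ring.two_ne_zero hF
  have key : complexQuadraticChar F (-u) * G * T =
      ∑ v : F, ψ (-(y * v)) * ((if v ^ 2 = 1 then (Fintype.card F : ℂ) else 0) - 1) := by
    have e1 : ∀ t ∈ univ.erase (0 : F), complexQuadraticChar F (-u) * G *
        (complexQuadraticChar F t * ψ (u * t + y ^ 2 / (4 * u) / t)) =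
        ∑ v : F, ψ (-(y * v)) * ψ (t * (u * (1 - v ^ 2))) := by
      intro t ht
      have ht : t ≠ 0 := Finset.ne_of_mem_erase ht
      have h3 := sum_mul_sq hF hψ (mul_ne_zero (neg_ne_zero.2 hu) ht)
      rw [map_mul] at h3
      calc _ = (complexQuadraticChar F (-u) * complexQuadraticChar F t * G) *
            ψ (u * t + y ^ 2 / (4 * u) / t) := by ring
        _ = _ := by
          rw [← h3, Finset.sum_mul,
            ← Equiv.sum_comp (Equiv.addRight (y / (2 * u * t)))]
          refine Finset.sum_congr rfl fun v _ => ?_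
          rw [← AddChar.map_add_eq_mul, ← AddChar.map_add_eq_mul, Equiv.coe_addRight]
          congr 1
          have h4 : (4 : F) ≠ 0 := by
            have : (4 : F) = 2 * 2 := by norm_num
            rw [this]; exact mul_ne_zero h2 h2
          field_simp
          ring
    rw [Finset.mul_sum, Finset.sum_congr rfl e1, Finset.sum_comm]
    refine Finset.sum_congr rfl fun v _ => ?_
    rw [← Finset.mul_sum, sum_erase_zero_mul hψ]
    congr 3
    rw [mul_eq_zero, or_iff_right hu, sub_eq_zero, @eq_comm _ (v ^ 2)]
  have hone : (1 : F) ≠ -1 := by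
    intro h; apply h2; linear_combination h
  have hfil : ({v : F | v ^ 2 = 1} : Finset F) = {1, -1} := by
    ext v; simp
  have key2 : ∑ v : F, ψ (-(y * v)) * ((if v ^ 2 = 1 then (Fintype.card F : ℂ) else 0) - 1) =
      Fintype.card F * (ψ (-y) + ψ y - if y = 0 then 1 else 0) := by
    have h5 : ∑ v : F, ψ (-(y * v)) = if y = 0 then (Fintype.card F : ℂ) else 0 := by
      have := AddChar.sum_mulShift (-y) hψ
      simpa [mul_comm] using this
    simp only [mul_sub, mul_one, Finset.sum_sub_distrib, h5, mul_ite, mul_zero,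
      ← Finset.sum_filter, hfil]
    rw [Finset.sum_pair hone]
    split_ifs <;> simp <;> ring
  have hb : ‖ψ (-y) + ψ y - if y = 0 then 1 else 0‖ ≤ 2 := by
    split_ifs with h
    · subst h; norm_num
    · rw [sub_zero]
      refine (norm_add_le _ _).trans ?_
      rw [AddChar.norm_apply, AddChar.norm_apply]; norm_num
  have h6 := congrArg (fun z : ℂ => ‖z‖ ^ 2) (key.trans key2)
  simp only [norm_mul, norm_complexQuadraticChar (neg_ne_zero.2 hu), one_mul, mul_pow, hG,
    norm_gaussSum_sq hF hψ, Complex.norm_natCast] at h6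
  have hq : (0 : ℝ) < Fintype.card F := by exact_mod_cast Fintype.card_pos
  have h7 : ‖T‖ ^ 2 = Fintype.card F * ‖ψ (-y) + ψ y - if y = 0 then 1 else 0‖ ^ 2 := by
    apply mul_left_cancel₀ hq.ne'
    rw [h6]; ring
  rw [h7]
  have h8 := pow_le_pow_left₀ (norm_nonneg _) hb 2
  nlinarith

/-- The Salié sum vanishes when the product of its parameters is a non-square. -/
lemma salie_eq_zero (ψ : AddChar F ℂ) {u b : F} (hub : ¬ IsSquare (u * b)) :
    ∑ t ∈ univ.erase (0 : F), complexQuadraticChar F t * ψ (u * t + b / t) = 0 := by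
  have hub0 : u * b ≠ 0 := fun h => hub (h ▸ IsSquare.zero)
  have hu := left_ne_zero_of_mul hub0
  have hb := right_ne_zero_of_mul hub0
  have hχ : complexQuadraticChar F (b / u) = -1 := by
    have h1 : ¬ IsSquare (b / u) := by
      rintro ⟨c, hc⟩
      exact hub ⟨u * c, by rw [div_eq_iff hu] at hc; rw [hc]; ring⟩
    rw [complexQuadraticChar_apply, quadraticChar_neg_one_iff_not_isSquare.2 h1]; norm_num
  have h : ∑ t ∈ univ.erase (0 : F), complexQuadraticChar F t * ψ (u * t + b / t) =
      ∑ t ∈ univ.erase (0 : F), -(complexQuadraticChar F t * ψ (u * t + b / t)) := by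
    refine Finset.sum_nbij' (fun t => b / u / t) (fun t => b / u / t) ?_ ?_ ?_ ?_ ?_
    · intro t ht; simp_all
    · intro t ht; simp_all
    · intro t ht; have : t ≠ 0 := Finset.ne_of_mem_erase ht; field_simp
    · intro t ht; have : t ≠ 0 := Finset.ne_of_mem_erase ht; field_simp
    · intro t ht
      have ht : t ≠ 0 := Finset.ne_of_mem_erase ht
      have h1 : complexQuadraticChar F (b / u / t) = -complexQuadraticChar F t := by
        have h2 : complexQuadraticChar F (b / u / t) * complexQuadraticChar F t = -1 := by
          rw [← map_mul, div_mul_cancel₀ _ ht, hχ]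
        calc _ = complexQuadraticChar F (b / u / t) *
              (complexQuadraticChar F t * complexQuadraticChar F t) := by
              rw [complexQuadraticChar_sq ht, mul_one]
          _ = _ := by rw [← mul_assoc, h2]; ring
      rw [h1, neg_mul, neg_neg]
      congr 2
      field_simp
      ring
  rw [Finset.sum_neg_distrib] at h
  exact self_eq_neg.1 h

lemma norm_salie_le (hF : ringChar F ≠ 2) {ψ : AddChar F ℂ} (hψ : ψ.IsPrimitive) {u : F}
    (hu : u ≠ 0) (b : F) :
    ‖∑ t ∈ univ.erase (0 : F), complexQuadraticChar F t * ψ (u * t + b / t)‖ ^ 2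
      ≤ 4 * Fintype.card F := by
  by_cases h : IsSquare (u * b)
  · obtain ⟨c, hc⟩ := h
    have h2 := Ring.two_ne_zero hF
    have h4 : (4 : F) ≠ 0 := by
      have : (4 : F) = 2 * 2 := by norm_num
      rw [this]; exact mul_ne_zero h2 h2
    have hb : b = (2 * c) ^ 2 / (4 * u) := by
      field_simp
      linear_combination 4 * hc
    rw [hb]
    exact norm_salie_le_of_sq hF hψ hu _
  · rw [salie_eq_zero ψ h]; simp

end ExponentialSums

/-! ### Fourier analysis on `ι → F` -/

section Fourier
variable {F : Type*} [Field F] [Fintype F] [DecidableEq F]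
  {ι : Type*} [Fintype ι] [DecidableEq ι]

lemma sum_addChar_dotProduct {ψ : AddChar F ℂ} (hψ : ψ.IsPrimitive) (z : ι → F) :
    ∑ ξ : ι → F, ψ (ξ ⬝ᵥ z) = if z = 0 then (Fintype.card F : ℂ) ^ Fintype.card ι else 0 := by
  have h1 : ∀ ξ : ι → F, ψ (ξ ⬝ᵥ z) = ∏ i, ψ (ξ i * z i) := fun ξ => by
    exact map_prod ψ.toMonoidHom (fun i => Multiplicative.ofAdd (ξ i * z i)) univ
  simp_rw [h1]
  have h2 := Finset.prod_univ_sum (fun _ : ι => (univ : Finset F)) (fun i x => ψ (x * z i))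
  rw [Fintype.piFinset_univ] at h2
  rw [← h2]
  simp_rw [AddChar.sum_mulShift _ hψ]
  split_ifs with hz
  · subst hz; simp
  · obtain ⟨i, hi⟩ := Function.ne_iff.1 hz
    exact Finset.prod_eq_zero (Finset.mem_univ i) (by simpa using hi)

lemma sum_norm_sq_addChar {ψ : AddChar F ℂ} (hψ : ψ.IsPrimitive) (P : Finset (ι → F)) :
    ∑ ξ : ι → F, ‖∑ x ∈ P, ψ (ξ ⬝ᵥ x)‖ ^ 2 = (Fintype.card F : ℝ) ^ Fintype.card ι * #P := by
  have h : ∀ ξ : ι → F, ((‖∑ x ∈ P, ψ (ξ ⬝ᵥ x)‖ ^ 2 : ℝ) : ℂ) =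
      ∑ x ∈ P, ∑ y ∈ P, ψ (ξ ⬝ᵥ (x - y)) := by
    intro ξ
    rw [Complex.ofReal_pow, ← Complex.mul_conj', map_sum, Finset.sum_mul_sum]
    refine Finset.sum_congr rfl fun x _ => Finset.sum_congr rfl fun y _ => ?_
    rw [← AddChar.map_neg_eq_conj, ← AddChar.map_add_eq_mul, dotProduct_sub, sub_eq_add_neg]
  have h2 : ((∑ ξ : ι → F, ‖∑ x ∈ P, ψ (ξ ⬝ᵥ x)‖ ^ 2 : ℝ) : ℂ) =
      (Fintype.card F : ℂ) ^ Fintype.card ι * #P := by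
    rw [Complex.ofReal_sum]
    simp_rw [h]
    rw [Finset.sum_comm]
    simp_rw [Finset.sum_comm (s := (univ : Finset (ι → F))), sum_addChar_dotProduct hψ, sub_eq_zero]
    simp [mul_comm]
  exact_mod_cast h2

/-- A convolution operator is bounded by the supremum of the Fourier transform of its kernel. -/
lemma norm_sum_sum_sub_le {ψ : AddChar F ℂ} (hψ : ψ.IsPrimitive) (k : (ι → F) → ℂ) {M : ℝ}
    (hM : ∀ ξ : ι → F, ‖∑ z, k z * ψ (ξ ⬝ᵥ z)‖ ≤ M) (P C : Finset (ι → F)) :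
    ‖∑ x ∈ P, ∑ c ∈ C, k (x - c)‖ ≤ M * √(#P) * √(#C) := by
  set N : ℝ := (Fintype.card F : ℝ) ^ Fintype.card ι with hN
  have hN0 : 0 < N := pow_pos (by exact_mod_cast Fintype.card_pos) _
  have hM0 : 0 ≤ M := (norm_nonneg _).trans (hM 0)
  have inv : ∀ w : ι → F, (N : ℂ) * k w =
      ∑ ξ : ι → F, (∑ z, k z * ψ (ξ ⬝ᵥ z)) * ψ (-(ξ ⬝ᵥ w)) := by
    intro w
    simp_rw [Finset.sum_mul, mul_assoc, ← AddChar.map_add_eq_mul, ← sub_eq_add_neg,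
      ← dotProduct_sub]
    rw [Finset.sum_comm]
    simp_rw [← Finset.mul_sum, sum_addChar_dotProduct hψ, sub_eq_zero]
    simp [hN, mul_comm]
  have main : (N : ℂ) * ∑ x ∈ P, ∑ c ∈ C, k (x - c) =
      ∑ ξ : ι → F, (∑ z, k z * ψ (ξ ⬝ᵥ z)) *
        ((starRingEnd ℂ) (∑ x ∈ P, ψ (ξ ⬝ᵥ x)) * ∑ c ∈ C, ψ (ξ ⬝ᵥ c)) := by
    have h : (N : ℂ) * ∑ x ∈ P, ∑ c ∈ C, k (x - c) = ∑ x ∈ P, ∑ c ∈ C, (N : ℂ) * k (x - c) := by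
      simp_rw [Finset.mul_sum]
    rw [h]
    simp_rw [inv, Finset.sum_comm (t := (univ : Finset (ι → F)))]
    refine Finset.sum_congr rfl fun ξ _ => ?_
    rw [map_sum, Finset.sum_mul_sum, Finset.mul_sum]
    refine Finset.sum_congr rfl fun x _ => ?_
    rw [Finset.mul_sum]
    refine Finset.sum_congr rfl fun c _ => ?_
    rw [← AddChar.map_neg_eq_conj, ← AddChar.map_add_eq_mul, dotProduct_sub]
    congr 2
    ring
  have bound : N * ‖∑ x ∈ P, ∑ c ∈ C, k (x - c)‖ ≤ N * (M * √(#P) * √(#C)) := by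
    calc N * ‖∑ x ∈ P, ∑ c ∈ C, k (x - c)‖
        = ‖(N : ℂ) * ∑ x ∈ P, ∑ c ∈ C, k (x - c)‖ := by
          rw [norm_mul, Complex.norm_real, Real.norm_of_nonneg hN0.le]
      _ ≤ ∑ ξ : ι → F, M * (‖∑ x ∈ P, ψ (ξ ⬝ᵥ x)‖ * ‖∑ c ∈ C, ψ (ξ ⬝ᵥ c)‖) := by
          rw [main]
          refine (norm_sum_le _ _).trans (Finset.sum_le_sum fun ξ _ => ?_)
          rw [norm_mul, norm_mul, RCLike.norm_conj]
          exact mul_le_mul_of_nonneg_right (hM ξ) (by positivity)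
      _ ≤ M * (√(N * #P) * √(N * #C)) := by
          rw [← Finset.mul_sum, ← sum_norm_sq_addChar hψ, ← sum_norm_sq_addChar hψ]
          exact mul_le_mul_of_nonneg_left (Real.sum_mul_le_sqrt_mul_sqrt _ _ _) hM0
      _ = N * (M * √(#P) * √(#C)) := by
          rw [Real.sqrt_mul hN0.le, Real.sqrt_mul hN0.le]
          linear_combination M * √(#P) * √(#C) * Real.mul_self_sqrt hN0.le
  exact le_of_mul_le_mul_left bound hN0

end Fourier

/-! ### The Fourier transform of a sphere -/

section Sphere
variable {F : Type*} [Field F]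

/-- The form `x₁x₂ + ⋯ + x_{2m-1}x_{2m} - e·x_{2m+1}²`. -/
def oddForm (e : F) (m : ℕ) (x : Fin (2 * m + 1) → F) : F :=
  pairsForm m x - e * x (Fin.last (2 * m)) ^ 2

lemma oddForm_cons_cons (e : F) (m : ℕ) (a b : F) (x : Fin (2 * m + 1) → F) :
    oddForm e (m + 1) (Fin.cons a (Fin.cons b x : Fin (2 * m + 2) → F) : Fin (2 * m + 3) → F) =
      a * b + oddForm e m x := by
  have h1 : pairsForm (m + 1)
      (Fin.cons a (Fin.cons b x : Fin (2 * m + 2) → F) : Fin (2 * m + 3) → F) =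
      a * b + pairsForm m x := by
    unfold pairsForm
    rw [Finset.sum_range_succ', add_comm]
    congr 1
    refine Finset.sum_congr rfl fun j hj => ?_
    have hj := Finset.mem_range.1 hj
    rw [dif_pos (by omega), dif_pos (by omega)]
    rfl
  unfold oddForm
  rw [h1, add_sub_assoc]
  rfl

lemma sum_fin_succ {α : Type*} [Fintype α] {n : ℕ} (f : (Fin (n + 1) → α) → ℂ) :
    ∑ z, f z = ∑ a : α, ∑ x : Fin n → α, f (Fin.cons a x : Fin (n + 1) → α) := by
  rw [← (Fin.consEquiv fun _ : Fin (n + 1) => α).sum_comp, Fintype.sum_prod_type]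
  rfl

variable [Fintype F]

lemma sum_addChar_quadratic (hF : ringChar F ≠ 2) (ψ : AddChar F ℂ) (c : F) {s : F}
    (hs : s ≠ 0) :
    ∑ w : F, ψ (s * w ^ 2 + c * w) = ψ (-(c ^ 2 / 4) / s) * ∑ w : F, ψ (s * w ^ 2) := by
  have h2 : (2 : F) ≠ 0 := Ring.two_ne_zero hF
  have h4 : (4 : F) ≠ 0 := by
    have : (4 : F) = 2 * 2 := by norm_num
    rw [this]; exact mul_ne_zero h2 h2
  rw [Finset.mul_sum, ← Equiv.sum_comp (Equiv.addRight (c / (2 * s))) fun w => _ * ψ (s * w ^ 2)]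
  refine Finset.sum_congr rfl fun w _ => ?_
  rw [← AddChar.map_add_eq_mul, Equiv.coe_addRight]
  congr 1
  field_simp
  ring

variable [DecidableEq F]

lemma sum_addChar_hyperbolic {ψ : AddChar F ℂ} (hψ : ψ.IsPrimitive) (α β : F) {t : F}
    (ht : t ≠ 0) :
    ∑ a : F, ∑ b : F, ψ (t * (a * b) + (α * a + β * b)) =
      Fintype.card F * ψ (-(α * β) / t) := by
  have h : ∀ a b : F, ψ (t * (a * b) + (α * a + β * b)) = ψ (α * a) * ψ (b * (t * a + β)) := by
    intro a b
    rw [← AddChar.map_add_eq_mul]; congr 1; ring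
  simp_rw [h, ← Finset.mul_sum, AddChar.sum_mulShift _ hψ]
  rw [Finset.sum_eq_single (-β / t)]
  · have h0 : t * (-β / t) + β = 0 := by field_simp; ring
    rw [if_pos h0, mul_comm]
    congr 2
    ring
  · intro a _ ha
    rw [if_neg]
    · simp
    · intro h0
      apply ha
      rw [eq_div_iff ht]
      linear_combination h0
  · simp

lemma exists_sum_addChar_oddForm (hF : ringChar F ≠ 2) {ψ : AddChar F ℂ} (hψ : ψ.IsPrimitive)
    {e : F} (he : e ≠ 0) (m : ℕ) (ξ : Fin (2 * m + 1) → F) :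
    ∃ s : F, ∀ t : F, t ≠ 0 → ∑ z, ψ (t * oddForm e m z + ξ ⬝ᵥ z) =
      (Fintype.card F : ℂ) ^ m * ψ (s / t) *
        (complexQuadraticChar F (-e * t) * gaussSum (complexQuadraticChar F) ψ) := by
  induction m with
  | zero =>
    refine ⟨ξ 0 ^ 2 / 4 / e, fun t ht => ?_⟩
    have hs : -e * t ≠ 0 := mul_ne_zero (neg_ne_zero.2 he) ht
    rw [← sum_mul_sq hF hψ hs, pow_zero, one_mul]
    have h := sum_addChar_quadratic hF ψ (ξ 0) hs
    have e1 : -(ξ 0 ^ 2 / 4) / (-e * t) = ξ 0 ^ 2 / 4 / e / t := by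
      rw [neg_mul, neg_div_neg_eq, div_div _ e t]
    rw [e1] at h
    rw [← h, ← (Equiv.funUnique (Fin 1) F).symm.sum_comp]
    refine Finset.sum_congr rfl fun w _ => ?_
    congr 1
    simp [oddForm, pairsForm, dotProduct]
    ring
  | succ m ih =>
    obtain ⟨s, hs⟩ := ih fun i => ξ i.succ.succ
    refine ⟨s - ξ 0 * ξ 1, fun t ht => ?_⟩
    have h1 := sum_addChar_hyperbolic hψ (ξ 0) (ξ 1) ht
    have h2 := hs t ht
    calc ∑ z, ψ (t * oddForm e (m + 1) z + ξ ⬝ᵥ z)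
        = ∑ a : F, ∑ b : F, ∑ x : Fin (2 * m + 1) → F,
            ψ (t * (a * b) + (ξ 0 * a + ξ 1 * b)) *
              ψ (t * oddForm e m x + (fun i => ξ i.succ.succ) ⬝ᵥ x) := by
          rw [sum_fin_succ]
          refine Finset.sum_congr rfl fun a _ => ?_
          refine (sum_fin_succ (n := 2 * m + 1) _).trans ?_
          refine Finset.sum_congr rfl fun b _ => Finset.sum_congr rfl fun x _ => ?_
          rw [← AddChar.map_add_eq_mul]
          congr 1
          have h3 : ξ ⬝ᵥ (Fin.cons a (Fin.cons b x : Fin (2 * m + 2) → F) : Fin (2 * m + 3) → F) =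
              ξ 0 * a + (ξ 1 * b + (fun i => ξ i.succ.succ) ⬝ᵥ x) := by
            unfold dotProduct
            refine (Fin.sum_univ_succ _).trans ?_
            congr 1
            refine (Fin.sum_univ_succ _).trans ?_
            rfl
          rw [oddForm_cons_cons]
          refine (congrArg _ h3).trans ?_
          ring
      _ = _ := by
          simp_rw [← Finset.mul_sum, ← Finset.sum_mul]
          rw [h1, h2]
          have h4 : (s - ξ 0 * ξ 1) / t = -(ξ 0 * ξ 1) / t + s / t := by ring
          rw [h4, AddChar.map_add_eq_mul, pow_succ]
          ring

lemma norm_fourier_sphere_le (hF : ringChar F ≠ 2) {ψ : AddChar F ℂ} (hψ : ψ.IsPrimitive)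
    {e r : F} (he : e ≠ 0) (hr : r ≠ 0) (m : ℕ) (ξ : Fin (2 * m + 1) → F) :
    ‖∑ z, ((if oddForm e m z = r then 1 else 0) - (Fintype.card F : ℂ)⁻¹) * ψ (ξ ⬝ᵥ z)‖
      ≤ 2 * (Fintype.card F : ℝ) ^ m := by
  have hq : (0 : ℝ) < Fintype.card F := by exact_mod_cast Fintype.card_pos
  have hqC : (Fintype.card F : ℂ) ≠ 0 := by exact_mod_cast hq.ne'
  obtain ⟨s, hs⟩ := exists_sum_addChar_oddForm hF hψ he m ξ
  set G := gaussSum (complexQuadraticChar F) ψ with hG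
  set T := ∑ t ∈ univ.erase (0 : F), complexQuadraticChar F t * ψ (-r * t + s / t) with hT
  have key : (Fintype.card F : ℂ) *
      ∑ z, ((if oddForm e m z = r then 1 else 0) - (Fintype.card F : ℂ)⁻¹) * ψ (ξ ⬝ᵥ z) =
      (Fintype.card F : ℂ) ^ m * complexQuadraticChar F (-e) * G * T := by
    have h1 : ∀ z : Fin (2 * m + 1) → F, (Fintype.card F : ℂ) *
        (((if oddForm e m z = r then 1 else 0) - (Fintype.card F : ℂ)⁻¹) * ψ (ξ ⬝ᵥ z)) =
        ∑ t ∈ univ.erase (0 : F), ψ (-r * t) * ψ (t * oddForm e m z + ξ ⬝ᵥ z) := by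
      intro z
      have h2 := sum_erase_zero_mul hψ (oddForm e m z - r)
      simp only [sub_eq_zero] at h2
      rw [← mul_assoc, mul_sub, mul_inv_cancel₀ hqC, mul_ite, mul_one, mul_zero, ← h2,
        Finset.sum_mul]
      refine Finset.sum_congr rfl fun t _ => ?_
      rw [← AddChar.map_add_eq_mul, ← AddChar.map_add_eq_mul]
      congr 1
      ring
    rw [Finset.mul_sum]
    simp_rw [h1]
    rw [Finset.sum_comm, hT, Finset.mul_sum]
    refine Finset.sum_congr rfl fun t ht => ?_
    rw [← Finset.mul_sum, hs t (Finset.ne_of_mem_erase ht), AddChar.map_add_eq_mul,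
      map_mul (complexQuadraticChar F)]
    ring
  have hT2 : ‖T‖ ^ 2 ≤ 4 * Fintype.card F := norm_salie_le hF hψ (neg_ne_zero.2 hr) s
  have hG2 : ‖G‖ ^ 2 = Fintype.card F := norm_gaussSum_sq hF hψ
  have hGT : ‖G‖ * ‖T‖ ≤ 2 * Fintype.card F := by
    refine (sq_le_sq₀ (by positivity) (by positivity)).1 ?_
    rw [mul_pow, hG2]
    nlinarith
  have h3 := congrArg norm key
  rw [norm_mul, norm_mul, norm_mul, norm_mul, norm_complexQuadraticChar (neg_ne_zero.2 he),
    norm_pow, Complex.norm_natCast, mul_one, mul_assoc] at h3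
  refine le_of_mul_le_mul_left ?_ hq
  rw [h3]
  calc _ ≤ (Fintype.card F : ℝ) ^ m * (2 * Fintype.card F) := by gcongr
    _ = _ := by ring

/-- The incidence bound for spheres of a fixed non-zero radius, in terms of their centers. -/
lemma abs_incidences_sub_le (hF : ringChar F ≠ 2) {e r : F} (he : e ≠ 0) (hr : r ≠ 0) (m : ℕ)
    (P C : Finset (Fin (2 * m + 1) → F)) :
    |(∑ x ∈ P, ∑ c ∈ C, if oddForm e m (x - c) = r then (1 : ℝ) else 0) -
        (Fintype.card F : ℝ)⁻¹ * #P * #C| ≤ 2 * (Fintype.card F : ℝ) ^ m * √(#P) * √(#C) := by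
  have hψ := AddChar.FiniteField.primitiveChar_to_Complex_isPrimitive F
  have h := norm_sum_sum_sub_le hψ _ (norm_fourier_sphere_le hF hψ he hr m) P C
  refine le_of_eq_of_le ?_ h
  rw [← Real.norm_eq_abs, ← Complex.norm_real]
  congr 1
  simp only [Finset.sum_sub_distrib, Finset.sum_const, nsmul_eq_mul]
  push_cast [apply_ite (Complex.ofReal)]
  ring

end Sphere

/-- Elementary Iosevich–Rudnev bound in odd dimensions: incidence bound for
`Q_i^d`-spheres of a fixed non-zero radius. -/
theorem stmt12 {F : Type*} [Field F] [Fintype F] [DecidableEq F]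
    (hq : Odd (Fintype.card F)) {d : ℕ} (hd : 3 ≤ d) (hdodd : Odd d)
    (i : ℕ) (hi : i = 3 ∨ i = 4) (a : F) (ha : ¬ IsSquare a)
    (r : F) (hr : r ≠ 0)
    (P : Finset (Fin d → F)) (hP : P.Nonempty)
    (S : Finset ((Fin d → F) × F)) (hSne : S.Nonempty)
    (hS : ∀ s ∈ S, s.2 = r) :
    |(sphIncid (Qi a i) P S : ℝ) - (Fintype.card F : ℝ)⁻¹ * P.card * S.card|
      < 3 * (Fintype.card F : ℝ) ^ ((d-1)/2)
          * Real.sqrt P.card * Real.sqrt S.card := by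
  have hF : ringChar F ≠ 2 := by
    intro h
    have h0 := FiniteField.even_card_of_char_two h
    rw [Nat.odd_iff] at hq
    omega
  obtain ⟨m, rfl⟩ := hdodd
  have hm : (2 * m + 1 - 1) / 2 = m := by omega
  obtain ⟨e, he, hQ⟩ : ∃ e : F, e ≠ 0 ∧ ∀ x : Fin (2 * m + 1) → F, Qi a i x = oddForm e m x := by
    rcases hi with rfl | rfl
    · refine ⟨1, one_ne_zero, fun x => ?_⟩
      simp only [Qi, Q3form, oddForm, hm, one_mul]
      rfl
    · refine ⟨a, fun h => ha (h ▸ IsSquare.zero), fun x => ?_⟩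
      simp only [Qi, Q4form, oddForm, hm]
      rfl
  have hinj : Set.InjOn Prod.fst (S : Set ((Fin (2 * m + 1) → F) × F)) := fun s hs s' hs' h =>
    Prod.ext h ((hS s hs).trans (hS s' hs').symm)
  have hcard : #(S.image Prod.fst) = #S := Finset.card_image_of_injOn hinj
  have hI : (sphIncid (Qi a i) P S : ℝ) =
      ∑ x ∈ P, ∑ c ∈ S.image Prod.fst, if oddForm e m (x - c) = r then (1 : ℝ) else 0 := by
    rw [sphIncid, Finset.card_filter, Finset.sum_product]
    push_cast
    refine Finset.sum_congr rfl fun x _ => ?_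
    rw [Finset.sum_image hinj]
    refine Finset.sum_congr rfl fun s hs => ?_
    rw [hQ, hS s hs]
  have hbound := abs_incidences_sub_le hF he hr m P (S.image Prod.fst)
  rw [hcard, ← hI] at hbound
  rw [hm]
  refine hbound.trans_lt ?_
  have hq0 : (0 : ℝ) < Fintype.card F := by exact_mod_cast Fintype.card_pos
  have hP0 : (0 : ℝ) < #P := by exact_mod_cast hP.card_pos
  have hS0 : (0 : ℝ) < #S := by exact_mod_cast hSne.card_pos
  gcongr
  norm_num
end

section
/- Let d ≥ 4 be even, let q be an odd prime power, let i ∈ {1,2}, and write Q = Q_i^d. Let s₁, s₂ be Q-spheres with distinct centers c₁ ≠ c₂, equal radii r₁ = r₂ = r, and Q(c₁−c₂) = 0. If r ≠ 0, then |s₁ ∩ s₂| = q^{d−2} + (−1)^{i}·q^{(d−2)/2}; if r = 0, then |s₁ ∩ s₂| = q^{d−2} + (−1)^{i+1}·(q^{d/2} − q^{(d−2)/2}). -/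
open Finset

section Helpers
variable {F : Type*} [Field F]

/-- `Q` behaves like a nondegenerate quadratic form: along each direction `c` it expands through a
linear functional (the polar form at `c`), which is nonzero when `c` is. -/
def HasNondegeneratePolar {d : ℕ} (Q : (Fin d → F) → F) : Prop :=
  ∀ c, ∃ L : (Fin d → F) →ₗ[F] F,
    (∀ x t, Q (x + t • c) = Q x + t * L x + t ^ 2 * Q c) ∧ L c = 2 * Q c ∧ (c ≠ 0 → L ≠ 0)

/-- Splitting off the first two coordinates. -/
def splitTwo (F : Type*) (d : ℕ) : (Fin (d + 2) → F) ≃ F × F × (Fin d → F) where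
  toFun x := (x 0, x 1, fun j => x j.succ.succ)
  invFun p := Fin.cons p.1 (Fin.cons p.2.1 p.2.2)
  left_inv x := by
    funext j
    refine Fin.cases rfl (fun j => ?_) j
    exact Fin.cases rfl (fun _ => rfl) j
  right_inv _ := rfl

/-- Restriction to all but the first two coordinates, as a linear map. -/
def tailTwo (F : Type*) [Field F] (d : ℕ) : (Fin (d + 2) → F) →ₗ[F] (Fin d → F) :=
  LinearMap.funLeft F F fun j : Fin d => j.succ.succ

theorem HasNondegeneratePolar.add_hyperbolic {d : ℕ} {Q : (Fin d → F) → F}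
    {Q' : (Fin (d + 2) → F) → F} (hQ' : ∀ x, Q' x = x 0 * x 1 + Q (fun j => x j.succ.succ))
    (hQ : HasNondegeneratePolar Q) : HasNondegeneratePolar Q' := by
  intro c
  obtain ⟨L, hexp, hself, hne⟩ := hQ (fun j => c j.succ.succ)
  let L' : (Fin (d + 2) → F) →ₗ[F] F :=
    c 0 • LinearMap.proj 1 + c 1 • LinearMap.proj 0 + L ∘ₗ tailTwo F d
  have hL' : ∀ x, L' x = c 0 * x 1 + c 1 * x 0 + L (fun j => x j.succ.succ) := fun _ => rfl
  refine ⟨L', fun x t => ?_, ?_, fun hc hzero => ?_⟩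
  · have h := hexp (fun j => x j.succ.succ) t
    have hfun : (fun j : Fin d => (x + t • c) j.succ.succ)
        = (fun j => x j.succ.succ) + t • fun j => c j.succ.succ := rfl
    rw [hQ', hQ', hQ', hL', hfun, h]
    simp only [Pi.add_apply, Pi.smul_apply, smul_eq_mul]
    ring
  · rw [hL', hQ', hself]
    ring
  · have heval : ∀ u v y, c 0 * v + c 1 * u + L y = 0 := fun u v y => by
      have h := hL' ((splitTwo F d).symm (u, v, y))
      rw [hzero] at h
      exact h.symm
    have h0 : c 0 = 0 := by simpa using heval 0 1 0
    have h1 : c 1 = 0 := by simpa using heval 1 0 0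
    have htail : (fun j : Fin d => c j.succ.succ) = 0 := by
      by_contra htail
      exact hne htail (LinearMap.ext fun y => by simpa using heval 0 0 y)
    apply hc
    apply (splitTwo F d).injective
    exact Prod.ext h0 (Prod.ext h1 htail)

theorem Q1form_add_two {d : ℕ} (x : Fin (d + 2) → F) :
    Q1form x = x 0 * x 1 + Q1form (fun j => x j.succ.succ) := by
  have hdiv : (d + 2) / 2 = d / 2 + 1 := by omega
  unfold Q1form pairsForm
  rw [hdiv, Finset.sum_range_succ', add_comm]
  congr 1
  refine Finset.sum_congr rfl fun j _ => ?_
  by_cases h : 2 * j + 1 < d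
  · rw [dif_pos h, dif_pos (by omega)]
    rfl
  · rw [dif_neg h, dif_neg (by omega)]

theorem Q2form_add_two (a : F) {d : ℕ} (hd : 2 ≤ d) (x : Fin (d + 2) → F) :
    Q2form a x = x 0 * x 1 + Q2form a (fun j => x j.succ.succ) := by
  obtain ⟨d, rfl⟩ := Nat.exists_eq_add_of_le' hd
  have hdiv : (d + 2 + 2 - 2) / 2 = (d + 2 - 2) / 2 + 1 := by omega
  unfold Q2form pairsForm
  rw [hdiv, Finset.sum_range_succ', dif_pos hd, dif_pos (by omega),
    add_comm (Finset.sum _ _), add_assoc]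
  congr 2
  refine Finset.sum_congr rfl fun j _ => ?_
  by_cases h : 2 * j + 1 < d + 2
  · rw [dif_pos h, dif_pos (by omega)]
    rfl
  · rw [dif_neg h, dif_neg (by omega)]

theorem Q2form_two (a : F) (x : Fin 2 → F) : Q2form a x = x 0 ^ 2 - a * x 1 ^ 2 := by
  simp [Q2form, pairsForm]

theorem Q2form_two_hasNondegeneratePolar {a : F} (ha : a ≠ 0) (h2 : (2 : F) ≠ 0) :
    HasNondegeneratePolar (Q2form a : (Fin 2 → F) → F) := by
  intro c
  let L : (Fin 2 → F) →ₗ[F] F :=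
    (2 * c 0) • LinearMap.proj 0 - (2 * a * c 1) • LinearMap.proj 1
  have hL : ∀ x, L x = 2 * c 0 * x 0 - 2 * a * c 1 * x 1 := fun _ => rfl
  refine ⟨L, fun x t => ?_, ?_, fun hc hzero => hc ?_⟩
  · simp only [Q2form_two, hL, Pi.add_apply, Pi.smul_apply, smul_eq_mul]
    ring
  · rw [hL, Q2form_two]
    ring
  · have h0 := hL ![1, 0]
    have h1 := hL ![0, 1]
    rw [hzero] at h0 h1
    funext j
    fin_cases j
    · simpa [h2] using h0
    · simpa [h2, ha] using h1

theorem Q1form_hasNondegeneratePolar (m : ℕ) :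
    HasNondegeneratePolar (Q1form : (Fin (2 * m) → F) → F) := by
  induction m with
  | zero =>
    exact fun c => ⟨0, fun x t => by simp [Q1form, pairsForm], by simp [Q1form, pairsForm],
      fun hc => (hc (funext fun j => j.elim0)).elim⟩
  | succ m ih => exact ih.add_hyperbolic Q1form_add_two

theorem Q2form_hasNondegeneratePolar {a : F} (ha : a ≠ 0) (h2 : (2 : F) ≠ 0) (m : ℕ) :
    HasNondegeneratePolar (Q2form a : (Fin (2 * (m + 1)) → F) → F) := by
  induction m with
  | zero => exact Q2form_two_hasNondegeneratePolar ha h2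
  | succ m ih => exact ih.add_hyperbolic (Q2form_add_two a (Nat.le_mul_of_pos_right 2 m.succ_pos))

variable [Fintype F]

local notation "q" => Fintype.card F

theorem exists_sq_sub_mul_sq_eq (hq : Odd q) {a : F} (ha : ¬ IsSquare a) (r : F) :
    ∃ u v : F, u ^ 2 - a * v ^ 2 = r := by
  have ha0 : a ≠ 0 := fun h => ha (h ▸ IsSquare.zero)
  have hr : (Polynomial.X ^ 2 - Polynomial.C r).degree = 2 :=
    Polynomial.degree_X_pow_sub_C two_pos r
  have hsq : (Polynomial.C (-a) * Polynomial.X ^ 2).degree = 2 :=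
    Polynomial.degree_C_mul_X_pow 2 (neg_ne_zero.mpr ha0)
  obtain ⟨u, v, huv⟩ := FiniteField.exists_root_sum_quadratic hr hsq (Nat.odd_iff.mp hq)
  refine ⟨u, v, ?_⟩
  simp only [Polynomial.eval_sub, Polynomial.eval_pow, Polynomial.eval_X, Polynomial.eval_C,
    Polynomial.eval_mul] at huv
  linear_combination huv

variable [DecidableEq F]

theorem card_fiber_add_hyperbolic {d : ℕ} {Q : (Fin d → F) → F} {Q' : (Fin (d + 2) → F) → F}
    (hQ' : ∀ x, Q' x = x 0 * x 1 + Q (fun j => x j.succ.succ)) (r : F) :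
    (#{x | Q' x = r} : ℤ) = q * #{x | Q x = r} + (q - 1) * q ^ d := by
  have hsum : #{x | Q' x = r}
      = ∑ u : F, ∑ y : Fin d → F, ∑ v : F, if u * v + Q y = r then 1 else 0 := by
    rw [Finset.card_filter, ← (splitTwo F d).symm.sum_comp, Fintype.sum_prod_type]
    refine Finset.sum_congr rfl fun u _ => ?_
    rw [Fintype.sum_prod_type_right]
    refine Finset.sum_congr rfl fun y _ => Finset.sum_congr rfl fun v _ => ?_
    rw [hQ']
    rfl
  have hunit : ∀ u ∈ Finset.univ.erase (0 : F),
      (∑ y : Fin d → F, ∑ v : F, if u * v + Q y = r then 1 else 0) = q ^ d := by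
    intro u hu
    have hu0 : u ≠ 0 := Finset.ne_of_mem_erase hu
    have hone : ∀ y, (∑ v : F, if u * v + Q y = r then 1 else 0) = 1 := fun y => by
      have hiff : ∀ v, u * v + Q y = r ↔ v = (r - Q y) / u := fun v => by
        rw [eq_div_iff hu0, eq_sub_iff_add_eq, mul_comm]
      simp [hiff]
    simp [hone]
  have hzero : (∑ y : Fin d → F, ∑ v : F, if 0 * v + Q y = r then 1 else 0)
      = q * #{x | Q x = r} := by
    rw [Finset.card_filter, Finset.mul_sum]
    exact Finset.sum_congr rfl fun y _ => by simp
  rw [hsum, ← Finset.add_sum_erase _ _ (Finset.mem_univ (0 : F)), hzero,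
    Finset.sum_congr rfl hunit, Finset.sum_const, Finset.card_erase_of_mem (Finset.mem_univ _),
    Finset.card_univ]
  rw [smul_eq_mul, Nat.cast_add, Nat.cast_mul, Nat.cast_mul, Nat.cast_pred Fintype.card_pos,
    Nat.cast_pow]

theorem card_Q1form_fiber (m : ℕ) (r : F) :
    (q * #{x : Fin (2 * m) → F | Q1form x = r} : ℤ)
      = q ^ (2 * m) + ((if r = 0 then (q : ℤ) ^ (m + 1) else 0) - q ^ m) := by
  induction m with
  | zero =>
    have h : ∀ x : Fin (2 * 0) → F, Q1form x = 0 := fun x => by simp [Q1form, pairsForm]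
    by_cases hr : r = 0
    · simp [h, hr]
    · simp [h, hr, Ne.symm hr]
  | succ m ih =>
    have h : (#{x : Fin (2 * (m + 1)) → F | Q1form x = r} : ℤ)
        = q * #{x : Fin (2 * m) → F | Q1form x = r} + (q - 1) * q ^ (2 * m) :=
      card_fiber_add_hyperbolic Q1form_add_two r
    rw [h, ih]
    split_ifs <;> ring

/-- Multiplication by an element of norm `r` embeds the elements of norm `s` into those of norm
`r * s`. -/
theorem card_Q2form_two_fiber_le (hq : Odd q) {a r : F} (ha : ¬ IsSquare a) (hr : r ≠ 0) (s : F) :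
    #{x : Fin 2 → F | Q2form a x = s} ≤ #{x : Fin 2 → F | Q2form a x = r * s} := by
  obtain ⟨u, v, huv⟩ := exists_sq_sub_mul_sq_eq hq ha r
  refine Finset.card_le_card_of_injOn
    (fun x => ![u * x 0 + a * v * x 1, u * x 1 + v * x 0]) ?_ ?_
  · intro x hx
    have hx : x 0 ^ 2 - a * x 1 ^ 2 = s := by simpa [Q2form_two] using hx
    simp only [Finset.coe_filter, Finset.mem_univ, true_and, Set.mem_ofPred_eq, Q2form_two,
      Matrix.cons_val_zero, Matrix.cons_val_one, ← huv, ← hx]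
    ring
  · intro x _ y _ hxy
    have h0 : u * x 0 + a * v * x 1 = u * y 0 + a * v * y 1 := congrFun hxy 0
    have h1 : u * x 1 + v * x 0 = u * y 1 + v * y 0 := congrFun hxy 1
    funext j
    apply mul_left_cancel₀ hr
    fin_cases j
    · change r * x 0 = r * y 0
      linear_combination u * h0 - a * v * h1 - (x 0 - y 0) * huv
    · change r * x 1 = r * y 1
      linear_combination u * h1 - v * h0 - (x 1 - y 1) * huv

theorem card_Q2form_two_fiber (hq : Odd q) {a : F} (ha : ¬ IsSquare a) (r : F) :
    (#{x : Fin 2 → F | Q2form a x = r} : ℤ) = if r = 0 then 1 else (q : ℤ) + 1 := by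
  have hzero : #{x : Fin 2 → F | Q2form a x = 0} = 1 := by
    rw [Finset.card_eq_one]
    refine ⟨0, Finset.ext fun x => ?_⟩
    simp only [Finset.mem_filter, Finset.mem_univ, true_and, Finset.mem_singleton, Q2form_two]
    refine ⟨fun hx => ?_, fun hx => by simp [hx]⟩
    have h1 : x 1 = 0 := by
      by_contra h1
      refine ha ⟨x 0 / x 1, ?_⟩
      field_simp
      linear_combination -hx
    have h0 : x 0 = 0 := by simpa [h1] using hx
    funext j
    fin_cases j
    · exact h0
    · exact h1
  have heq : ∀ s ≠ (0 : F),
      #{x : Fin 2 → F | Q2form a x = s} = #{x : Fin 2 → F | Q2form a x = 1} := fun s hs => by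
    apply le_antisymm
    · simpa [hs] using card_Q2form_two_fiber_le hq ha (inv_ne_zero hs) s
    · simpa using card_Q2form_two_fiber_le hq ha hs 1
  have htotal : (q : ℤ) ^ 2 = 1 + (q - 1) * #{x : Fin 2 → F | Q2form a x = 1} := by
    have h := Finset.card_eq_sum_card_fiberwise (s := (Finset.univ : Finset (Fin 2 → F)))
      (t := Finset.univ) (f := Q2form a) fun _ _ => Finset.mem_coe.mpr (Finset.mem_univ _)
    rw [← Finset.add_sum_erase _ _ (Finset.mem_univ (0 : F)), hzero,
      Finset.sum_congr rfl fun s hs => heq s (Finset.ne_of_mem_erase hs), Finset.sum_const,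
      Finset.card_erase_of_mem (Finset.mem_univ _), Finset.card_univ, Finset.card_univ,
      Fintype.card_fun, Fintype.card_fin, smul_eq_mul] at h
    rw [← Nat.cast_pred Fintype.card_pos]
    exact_mod_cast h
  split_ifs with hr
  · rw [hr, hzero, Nat.cast_one]
  · rw [heq r hr]
    have hq1 : (q : ℤ) - 1 ≠ 0 := by
      have := Fintype.one_lt_card (α := F)
      omega
    apply mul_left_cancel₀ hq1
    linear_combination -htotal

theorem card_Q2form_fiber (hq : Odd q) {a : F} (ha : ¬ IsSquare a) (m : ℕ) (r : F) :
    (q * #{x : Fin (2 * (m + 1)) → F | Q2form a x = r} : ℤ)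
      = q ^ (2 * (m + 1)) - ((if r = 0 then (q : ℤ) ^ (m + 2) else 0) - q ^ (m + 1)) := by
  induction m with
  | zero =>
    rw [show (#{x : Fin (2 * (0 + 1)) → F | Q2form a x = r} : ℤ) = _ from
      card_Q2form_two_fiber hq ha r]
    split_ifs <;> ring
  | succ m ih =>
    have h : (#{x : Fin (2 * (m + 1 + 1)) → F | Q2form a x = r} : ℤ)
        = q * #{x : Fin (2 * (m + 1)) → F | Q2form a x = r} + (q - 1) * q ^ (2 * (m + 1)) :=
      card_fiber_add_hyperbolic (Q2form_add_two a (Nat.le_mul_of_pos_right 2 m.succ_pos)) r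
    rw [h, ih]
    split_ifs <;> ring

theorem card_ker_mul_card {d : ℕ} {L : (Fin d → F) →ₗ[F] F} (hL : L ≠ 0) :
    q * #{x | L x = 0} = q ^ d := by
  have hrank := Module.Dual.finrank_ker_add_one_of_ne_zero hL
  rw [Module.finrank_fin_fun] at hrank
  have hcard : #{x | L x = 0} = Nat.card (LinearMap.ker L) := by
    rw [← Fintype.card_subtype, ← Nat.card_eq_fintype_card]
    rfl
  rw [hcard, Module.natCard_eq_pow_finrank (K := F), Nat.card_eq_fintype_card,
    ← pow_succ', hrank]

/-- A line in an isotropic direction `c` whose points are not orthogonal to `c` meets each level set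
of `Q` exactly once. -/
theorem card_mul_card_fiber_not_orthogonal {d : ℕ} {Q : (Fin d → F) → F} {c : Fin d → F}
    {L : (Fin d → F) →ₗ[F] F} (hexp : ∀ x t, Q (x + t • c) = Q x + t * L x) (hLc : L c = 0)
    (r : F) : q * #{x | Q x = r ∧ L x ≠ 0} = #{x | L x ≠ 0} := by
  rw [← Finset.card_univ, ← Finset.card_product]
  have hL : ∀ (x : Fin d → F) (t : F), L (x + t • c) = L x := fun x t => by simp [hLc]
  refine Finset.card_nbij' (fun p => p.2 + p.1 • c)
    (fun x => ((Q x - r) / L x, x + (-((Q x - r) / L x)) • c)) ?_ ?_ ?_ ?_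
  · intro p hp
    simp_all
  · intro x hx
    have hx : L x ≠ 0 := by simpa using hx
    simp only [Finset.coe_product, Finset.coe_univ, Finset.coe_filter, Finset.mem_univ, true_and,
      Set.mem_prod, Set.mem_univ, Set.mem_ofPred_eq, hexp, hL]
    refine ⟨?_, hx⟩
    field_simp
    ring
  · rintro ⟨t, x⟩ hx
    obtain ⟨hQ, hx⟩ : Q x = r ∧ L x ≠ 0 := by simpa using hx
    have ht : (Q (x + t • c) - r) / L (x + t • c) = t := by
      rw [hexp, hL, hQ]
      field_simp
      ring
    simp only [ht]
    simp
  · intro x _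
    simp

theorem card_fiber_inter_translate {d : ℕ} {Q : (Fin d → F) → F} (hQ : HasNondegeneratePolar Q)
    {c₁ c₂ : Fin d → F} (hc : c₁ ≠ c₂) (hiso : Q (c₁ - c₂) = 0) (r : F) :
    (q : ℤ) ^ 2 * #(spherePts Q (c₁, r) ∩ spherePts Q (c₂, r))
      = q ^ 2 * #{x | Q x = r} - q ^ (d + 1) + q ^ d := by
  obtain ⟨L, hexp, hLc, hne⟩ := hQ (c₁ - c₂)
  simp only [hiso, mul_zero, add_zero] at hexp hLc
  have hker := card_ker_mul_card (hne (sub_ne_zero.mpr hc))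
  have hlines := card_mul_card_fiber_not_orthogonal hexp hLc r
  have hcompl := Finset.card_filter_add_card_filter_not (s := Finset.univ) fun x => L x = 0
  have hsplit := Finset.card_filter_add_card_filter_not
    (s := Finset.univ.filter fun x => Q x = r) fun x => L x = 0
  rw [Finset.filter_filter, Finset.filter_filter] at hsplit
  have hinter : #(spherePts Q (c₁, r) ∩ spherePts Q (c₂, r)) = #{x | Q x = r ∧ L x = 0} := by
    refine Finset.card_nbij' (fun x => x - c₁) (fun x => x + c₁) ?_ ?_ ?_ ?_
    · intro x hx
      have h := hexp (x - c₁) 1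
      rw [one_smul, sub_add_sub_cancel, one_mul] at h
      simp only [spherePts, Finset.coe_inter, Finset.coe_filter, Finset.mem_univ, true_and,
        Set.mem_inter_iff, Set.mem_ofPred_eq] at hx ⊢
      exact ⟨hx.1, by rw [hx.1, hx.2] at h; simpa using h⟩
    · intro x hx
      have h := hexp x 1
      simp only [spherePts, Finset.coe_inter, Finset.coe_filter, Finset.mem_univ, true_and,
        Set.mem_inter_iff, Set.mem_ofPred_eq] at hx ⊢
      refine ⟨by simpa using hx.1, ?_⟩
      rw [one_smul, hx.1, hx.2, ← add_sub_assoc] at h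
      simpa using h
    · exact fun x _ => sub_add_cancel x c₁
    · exact fun x _ => add_sub_cancel_right x c₁
  rw [Finset.card_univ, Fintype.card_fun, Fintype.card_fin] at hcompl
  rw [hinter]
  simp only [← ne_eq] at hcompl hsplit
  zify at hker hlines hcompl hsplit
  rw [pow_succ]
  linear_combination (q : ℤ) ^ 2 * hsplit - q * hlines - q * hcompl + hker

end Helpers

/-- Intersection size of two `Q_i^d`-spheres (`i ∈ {1,2}`, even `d`) with equal
radii and distinct centers at distance zero. -/
theorem stmt15 {F : Type*} [Field F] [Fintype F] [DecidableEq F]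
    (hq : Odd (Fintype.card F)) {d : ℕ} (hd : 4 ≤ d) (hdeven : Even d)
    (i : ℕ) (hi : i = 1 ∨ i = 2) (a : F) (ha : ¬ IsSquare a)
    (c₁ c₂ : Fin d → F) (hc : c₁ ≠ c₂) (r : F)
    (ht : Qi a i (c₁ - c₂) = 0) :
    (r ≠ 0 →
      ((spherePts (Qi a i) (c₁, r) ∩ spherePts (Qi a i) (c₂, r)).card : ℤ)
        = (Fintype.card F : ℤ) ^ (d-2) + (-1) ^ i * (Fintype.card F : ℤ) ^ ((d-2)/2)) ∧
    (r = 0 →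
      ((spherePts (Qi a i) (c₁, r) ∩ spherePts (Qi a i) (c₂, r)).card : ℤ)
        = (Fintype.card F : ℤ) ^ (d-2) + (-1) ^ (i+1) *
            ((Fintype.card F : ℤ) ^ (d/2) - (Fintype.card F : ℤ) ^ ((d-2)/2))) := by
  
  have h2 : (2 : F) ≠ 0 :=
    Ring.two_ne_zero fun h => Nat.not_even_iff_odd.mpr hq
      (Nat.even_iff.mpr (FiniteField.even_card_of_char_two h))
  have ha0 : a ≠ 0 := fun h => ha (h ▸ IsSquare.zero)
  have hq0 : (Fintype.card F : ℤ) ^ 2 ≠ 0 := by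
    have := Fintype.card_pos (α := F)
    positivity
  obtain ⟨m, rfl⟩ : ∃ m, d = 2 * (m + 1) := by
    obtain ⟨k, rfl⟩ := hdeven
    exact ⟨k - 1, by omega⟩
  have hsub : 2 * (m + 1) - 2 = 2 * m := by omega
  have hhalf : 2 * m / 2 = m := by omega
  have hhalf' : 2 * (m + 1) / 2 = m + 1 := by omega
  rw [hsub, hhalf, hhalf']
  obtain rfl | rfl := hi
  · have hinter := card_fiber_inter_translate (Q1form_hasNondegeneratePolar (m + 1)) hc ht r
    have hcard := card_Q1form_fiber (m + 1) r
    change (r ≠ 0 → (#(spherePts Q1form (c₁, r) ∩ spherePts Q1form (c₂, r)) : ℤ) = _) ∧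
      (r = 0 → (#(spherePts Q1form (c₁, r) ∩ spherePts Q1form (c₂, r)) : ℤ) = _)
    constructor <;> intro hr <;> apply mul_left_cancel₀ hq0 <;> rw [hinter]
    · rw [if_neg hr] at hcard
      linear_combination (Fintype.card F : ℤ) * hcard
    · rw [if_pos hr] at hcard
      linear_combination (Fintype.card F : ℤ) * hcard
  · have hinter := card_fiber_inter_translate (Q2form_hasNondegeneratePolar ha0 h2 m) hc ht r
    have hcard := card_Q2form_fiber hq ha m r
    change (r ≠ 0 → (#(spherePts (Q2form a) (c₁, r) ∩ spherePts (Q2form a) (c₂, r)) : ℤ) = _) ∧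
      (r = 0 → (#(spherePts (Q2form a) (c₁, r) ∩ spherePts (Q2form a) (c₂, r)) : ℤ) = _)
    constructor <;> intro hr <;> apply mul_left_cancel₀ hq0 <;> rw [hinter]
    · rw [if_neg hr] at hcard
      linear_combination (Fintype.card F : ℤ) * hcard
    · rw [if_pos hr] at hcard
      linear_combination (Fintype.card F : ℤ) * hcard
end
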